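/- arXiv:2007.14593 — 10 statements merged into one kernel-verified Lean document; each statement's English description precedes it below -/
import Mathlib

section
/- Let X and Y be real Banach spaces, A : X → Y a continuous linear map, y ∈ Y, x₁*,…,x_p* continuous linear functionals on X, α₁,…,α_p real numbers, and let D = {x ∈ X : Ax = y and ⟨x_i*, x⟩ ≤ α_i for i = 1,…,p}. Then for every x̄ ∈ D, the contingent cone to D at x̄ satisfies T_D(x̄) = {v ∈ X : Av = 0 and ⟨x_i*, v⟩ ≤ 0 for all i ∈ I(x̄)}, where I(x̄) = {i ∈ {1,…,p} : ⟨x_i*, x̄⟩ = α_i} is the active index set at x̄. -/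
open Filter Topology

/-- The contingent (Bouligand) cone to `C` at `xb`. -/
def contingentCone {X : Type*} [NormedAddCommGroup X] [NormedSpace ℝ X]
    (C : Set X) (xb : X) : Set X :=
  {v | ∃ τ : ℕ → ℝ, ∃ vk : ℕ → X,
    (∀ k, 0 < τ k) ∧ Tendsto τ atTop (𝓝 0) ∧ Tendsto vk atTop (𝓝 v) ∧
    ∀ k, xb + τ k • vk k ∈ C}

theorem stmt_0 {X Y : Type*} [NormedAddCommGroup X] [NormedSpace ℝ X] [CompleteSpace X]
    [NormedAddCommGroup Y] [NormedSpace ℝ Y] [CompleteSpace Y]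
    (A : X →L[ℝ] Y) (y : Y) (p : ℕ) (xs : Fin p → (X →L[ℝ] ℝ)) (α : Fin p → ℝ)
    (D : Set X) (hD : D = {x | A x = y ∧ ∀ i, xs i x ≤ α i})
    (xb : X) (hxb : xb ∈ D) :
    contingentCone D xb = {v | A v = 0 ∧ ∀ i, xs i xb = α i → xs i v ≤ 0} := by
  subst hD
  obtain ⟨hA, hle⟩ := hxb
  ext v
  constructor
  · rintro ⟨τ, vk, hτ, -, hv, hmem⟩
    refine ⟨?_, fun i hi => ?_⟩
    · have h0 : ∀ k, A (vk k) = 0 := by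
        intro k
        have h := (hmem k).1
        rw [map_add, map_smul, hA, add_eq_left] at h
        exact (smul_eq_zero.mp h).resolve_left (hτ k).ne'
      have h1 := (A.continuous.tendsto v).comp hv
      refine tendsto_nhds_unique h1 ?_
      simp [Function.comp_def, h0]
    · refine le_of_tendsto (((xs i).continuous.tendsto v).comp hv) (Eventually.of_forall fun k => ?_)
      have h := (hmem k).2 i
      rw [map_add, map_smul, hi, smul_eq_mul] at h
      have h2 : τ k * xs i (vk k) ≤ 0 := by linarith
      exact nonpos_of_mul_nonpos_right h2 (hτ k)
  · rintro ⟨hv, hvi⟩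
    have hlim : Tendsto (fun k : ℕ => 1 / ((k : ℝ) + 1)) atTop (𝓝 0) :=
      tendsto_one_div_add_atTop_nhds_zero_nat
    have hev : ∀ᶠ k : ℕ in atTop, ∀ i, xs i (xb + (1 / ((k : ℝ) + 1)) • v) ≤ α i := by
      rw [eventually_all]
      intro i
      rcases (hle i).eq_or_lt with h | h
      · refine Eventually.of_forall fun k => ?_
        have h3 : (0 : ℝ) ≤ 1 / ((k : ℝ) + 1) := by positivity
        have h4 := mul_nonpos_of_nonneg_of_nonpos h3 (hvi i h)
        rw [map_add, map_smul, smul_eq_mul]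
        linarith
      · have h5 : Tendsto (fun k : ℕ => xs i (xb + (1 / ((k : ℝ) + 1)) • v)) atTop
            (𝓝 (xs i (xb + (0 : ℝ) • v))) :=
          ((xs i).continuous.tendsto _).comp ((hlim.smul_const v).const_add xb)
        rw [zero_smul, add_zero] at h5
        exact (h5.eventually_lt_const h).mono fun k hk => hk.le
    obtain ⟨N, hN⟩ := eventually_atTop.mp hev
    refine ⟨fun k => 1 / (((k + N : ℕ) : ℝ) + 1), fun _ => v, fun k => by positivity,
      hlim.comp (tendsto_add_atTop_nat N), tendsto_const_nhds, fun k => ⟨?_, hN (k + N) (by omega)⟩⟩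
    rw [map_add, map_smul, hv, smul_zero, add_zero, hA]
end

section
/- Let X and Y be real Banach spaces, A : X → Y a continuous linear map, y ∈ Y, x₁*,…,x_p* continuous linear functionals on X, α₁,…,α_p real numbers, and let D = {x ∈ X : Ax = y and ⟨x_i*, x⟩ ≤ α_i for i = 1,…,p}. Then for every x̄ ∈ D and every v in the contingent cone T_D(x̄), the second-order tangent set satisfies T²_D(x̄, v) = T_{T_D(x̄)}(v), i.e., the second-order tangent set to D at x̄ in direction v equals the contingent cone to the set T_D(x̄) at the point v. -/
open Filter Topology

/-- The second-order tangent set to `C` at `xb` in direction `v`. -/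
def secondOrderTangentSet {X : Type*} [NormedAddCommGroup X] [NormedSpace ℝ X]
    (C : Set X) (xb v : X) : Set X :=
  {w | ∃ τ : ℕ → ℝ, ∃ wk : ℕ → X,
    (∀ k, 0 < τ k) ∧ Tendsto τ atTop (𝓝 0) ∧ Tendsto wk atTop (𝓝 w) ∧
    ∀ k, xb + τ k • v + ((τ k) ^ 2 / 2) • wk k ∈ C}

lemma seq_of_ev {P : ℝ → Prop} (h : ∀ᶠ t in 𝓝[>] (0:ℝ), P t) :
    ∃ τ : ℕ → ℝ, (∀ k, 0 < τ k) ∧ Tendsto τ atTop (𝓝 0) ∧ ∀ k, P (τ k) := by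
  have h0 : Tendsto (fun n : ℕ => 1 / ((n : ℝ) + 1)) atTop (𝓝 0) :=
    tendsto_one_div_add_atTop_nhds_zero_nat
  have h1 : Tendsto (fun n : ℕ => 1 / ((n : ℝ) + 1)) atTop (𝓝[>] 0) := by
    refine tendsto_nhdsWithin_iff.2 ⟨h0, Eventually.of_forall fun n => ?_⟩
    show (0:ℝ) < 1 / ((n : ℝ) + 1)
    positivity
  obtain ⟨N, hN⟩ := eventually_atTop.1 (h1.eventually h)
  refine ⟨fun k => 1 / (((k + N : ℕ) : ℝ) + 1), fun k => by positivity,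
    h0.comp (tendsto_add_atTop_nat N), fun k => hN _ (by omega)⟩

lemma ev_le {f : ℝ → ℝ} (hf : Continuous f) {c : ℝ} (h : f 0 < c) :
    ∀ᶠ t in 𝓝[>] (0:ℝ), f t ≤ c :=
  ((hf.tendsto 0).mono_left nhdsWithin_le_nhds).eventually_le_const h

lemma cone_poly {X Y ι : Type*} [Finite ι] [NormedAddCommGroup X] [NormedSpace ℝ X]
    [NormedAddCommGroup Y] [NormedSpace ℝ Y]
    (A : X →L[ℝ] Y) (y : Y) (xs : ι → (X →L[ℝ] ℝ)) (α : ι → ℝ)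
    (xb : X) (h1 : A xb = y) (h2 : ∀ i, xs i xb ≤ α i) :
    contingentCone {x | A x = y ∧ ∀ i, xs i x ≤ α i} xb =
      {v | A v = 0 ∧ ∀ i, xs i xb = α i → xs i v ≤ 0} := by
  ext v
  constructor
  · rintro ⟨τ, vk, hp, -, hl, hm⟩
    refine ⟨?_, fun i hi => ?_⟩
    · have hz : ∀ k, A (vk k) = 0 := by
        intro k
        have := (hm k).1
        rw [map_add, map_smul, h1, add_eq_left] at this
        exact (smul_eq_zero.1 this).resolve_left (hp k).ne'
      have := (A.continuous.tendsto v).comp hl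
      refine tendsto_nhds_unique this ?_
      exact tendsto_const_nhds.congr fun k => (hz k).symm
    · refine le_of_tendsto (((xs i).continuous.tendsto v).comp hl) (Eventually.of_forall fun k => ?_)
      have := (hm k).2 i
      rw [map_add, map_smul, hi, smul_eq_mul] at this
      show xs i (vk k) ≤ 0
      have := hp k
      by_contra! hc
      nlinarith [mul_pos this hc]
  · rintro ⟨hA, hi⟩
    have : ∀ᶠ t in 𝓝[>] (0:ℝ), ∀ i, xs i xb + t * xs i v ≤ α i := by
      refine eventually_all.2 fun i => ?_
      rcases (h2 i).lt_or_eq with h | h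
      · exact ev_le (f := fun t => xs i xb + t * xs i v) (by fun_prop) (by simpa using h)
      · filter_upwards [self_mem_nhdsWithin] with t ht
        have : (0:ℝ) < t := ht
        nlinarith [hi i h]
    obtain ⟨τ, hp, hl, hm⟩ := seq_of_ev this
    exact ⟨τ, fun _ => v, hp, hl, tendsto_const_nhds, fun k => ⟨by simp [hA, h1],
      fun i => by simpa using hm k i⟩⟩

theorem stmt_1 {X Y : Type*} [NormedAddCommGroup X] [NormedSpace ℝ X] [CompleteSpace X]
    [NormedAddCommGroup Y] [NormedSpace ℝ Y] [CompleteSpace Y]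
    (A : X →L[ℝ] Y) (y : Y) (p : ℕ) (xs : Fin p → (X →L[ℝ] ℝ)) (α : Fin p → ℝ)
    (D : Set X) (hD : D = {x | A x = y ∧ ∀ i, xs i x ≤ α i})
    (xb : X) (hxb : xb ∈ D) (v : X) (hv : v ∈ contingentCone D xb) :
    secondOrderTangentSet D xb v = contingentCone (contingentCone D xb) v := by
  subst hD
  obtain ⟨h1, h2⟩ := hxb
  rw [cone_poly A y xs α xb h1 h2] at hv ⊢
  obtain ⟨hv1, hv2⟩ := hv
  have e : {v | A v = 0 ∧ ∀ i, xs i xb = α i → xs i v ≤ 0} =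
      {v | A v = 0 ∧ ∀ i : {i // xs i xb = α i}, xs i.1 v ≤ (fun _ => (0:ℝ)) i} := by
    ext u; simp
  rw [e, cone_poly A 0 (fun i : {i // xs i xb = α i} => xs i.1) (fun _ => (0:ℝ)) v hv1
    (fun i => hv2 i.1 i.2)]
  ext w
  constructor
  · rintro ⟨τ, wk, hp, -, hl, hm⟩
    refine ⟨?_, fun i hi => ?_⟩
    · have hz : ∀ k, A (wk k) = 0 := by
        intro k
        have := (hm k).1
        rw [map_add, map_add, map_smul, map_smul, h1, hv1, smul_zero, add_zero,
          add_eq_left] at this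
        have h3 := hp k
        exact (smul_eq_zero.1 this).resolve_left (by positivity)
      refine tendsto_nhds_unique ((A.continuous.tendsto w).comp hl) ?_
      exact tendsto_const_nhds.congr fun k => (hz k).symm
    · refine le_of_tendsto (((xs i.1).continuous.tendsto w).comp hl)
        (Eventually.of_forall fun k => ?_)
      have := (hm k).2 i.1
      have hi' : xs i.1 v = 0 := hi
      rw [map_add, map_add, map_smul, map_smul, i.2, hi', smul_eq_mul, smul_eq_mul] at this
      show xs i.1 (wk k) ≤ 0
      have h3 : 0 < τ k ^ 2 / 2 := by have := hp k; positivity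
      by_contra! hc
      nlinarith [mul_pos h3 hc]
  · rintro ⟨hA, hi⟩
    have : ∀ᶠ t in 𝓝[>] (0:ℝ), ∀ i, xs i xb + t * xs i v + t ^ 2 / 2 * xs i w ≤ α i := by
      refine eventually_all.2 fun i => ?_
      rcases (h2 i).lt_or_eq with h | h
      · exact ev_le (f := fun t => xs i xb + t * xs i v + t ^ 2 / 2 * xs i w) (by fun_prop)
          (by simpa using h)
      · rcases (hv2 i h).lt_or_eq with h' | h'
        · have := ev_le (f := fun t => xs i v + t / 2 * xs i w) (c := 0) (by fun_prop)
            (by simpa using h')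
          filter_upwards [self_mem_nhdsWithin, this] with t ht h4
          have : (0:ℝ) < t := ht
          nlinarith [mul_nonneg this.le (neg_nonneg.2 h4)]
        · filter_upwards with t
          have h5 : xs i w ≤ 0 := hi ⟨i, h⟩ h'
          rw [h, h']
          nlinarith [mul_nonneg (sq_nonneg t) (neg_nonneg.2 h5)]
    obtain ⟨τ, hp, hl, hm⟩ := seq_of_ev this
    exact ⟨τ, fun _ => w, hp, hl, tendsto_const_nhds, fun k => ⟨by simp [hA, h1, hv1],
      fun i => by simpa using hm k i⟩⟩
end

section
/- Let D ⊆ X be a generalized polyhedral convex set in a real Banach space X. Then for every x̄ ∈ D and every v in the contingent cone T_D(x̄), one has the inclusion T_D(x̄) ⊆ T²_D(x̄, v), where T²_D(x̄, v) is the second-order tangent set to D at x̄ in direction v. -/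
open Filter Topology

/-- `D` is a generalized polyhedral convex set. -/
def IsGPCS {X : Type*} [NormedAddCommGroup X] [NormedSpace ℝ X] (D : Set X) : Prop :=
  ∃ (p : ℕ) (xs : Fin p → (X →L[ℝ] ℝ)) (α : Fin p → ℝ) (L : AffineSubspace ℝ X),
    IsClosed (L : Set X) ∧ D = {x | x ∈ L ∧ ∀ i, xs i x ≤ α i}

theorem aux_cone {X : Type*} [NormedAddCommGroup X] [NormedSpace ℝ X]
    {p : ℕ} {xs : Fin p → (X →L[ℝ] ℝ)} {α : Fin p → ℝ} {L : AffineSubspace ℝ X}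
    (hL : IsClosed (L : Set X)) {xb : X} (hxb : xb ∈ L) {v : X}
    (hv : v ∈ contingentCone {x | x ∈ L ∧ ∀ i, xs i x ≤ α i} xb) :
    v ∈ L.direction ∧ ∀ i, xs i xb = α i → xs i v ≤ 0 := by
  obtain ⟨τ, vk, hpos, hτ, hvk, hmem⟩ := hv
  constructor
  · have h1 : xb + v ∈ (L : Set X) := by
      refine hL.mem_of_tendsto (hvk.const_add xb) (Eventually.of_forall fun k => ?_)
      have h2 : τ k • vk k ∈ L.direction := by
        have := AffineSubspace.vsub_mem_direction (hmem k).1 hxb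
        simpa using this
      have h3 : vk k ∈ L.direction := by
        have := L.direction.smul_mem (τ k)⁻¹ h2
        rwa [inv_smul_smul₀ (hpos k).ne'] at this
      have := AffineSubspace.vadd_mem_of_mem_direction h3 hxb
      rw [vadd_eq_add, add_comm] at this
      exact this
    have := AffineSubspace.vsub_mem_direction h1 hxb
    simpa using this
  · intro i hi
    refine le_of_tendsto (((xs i).continuous.tendsto v).comp hvk)
      (Eventually.of_forall fun k => ?_)
    have := (hmem k).2 i
    simp only [map_add, map_smul, smul_eq_mul, hi] at this
    simp only [Function.comp]
    by_contra! h
    have := mul_pos (hpos k) h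
    linarith

theorem stmt_2 {X : Type*} [NormedAddCommGroup X] [NormedSpace ℝ X] [CompleteSpace X]
    (D : Set X) (hD : IsGPCS D)
    (xb : X) (hxb : xb ∈ D) (v : X) (hv : v ∈ contingentCone D xb) :
    contingentCone D xb ⊆ secondOrderTangentSet D xb v := by
  obtain ⟨p, xs, α, L, hL, rfl⟩ := hD
  intro w hw
  obtain ⟨hv1, hv2⟩ := aux_cone hL hxb.1 hv
  obtain ⟨hw1, hw2⟩ := aux_cone hL hxb.1 hw
  have key : ∀ᶠ t : ℝ in 𝓝[>] 0, ∀ i, xs i (xb + t • v + (t ^ 2 / 2) • w) ≤ α i := by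
    rw [eventually_all]
    intro i
    rcases (hxb.2 i).lt_or_eq with h | h
    · have hc : Continuous fun t : ℝ => xs i (xb + t • v + (t ^ 2 / 2) • w) := by fun_prop
      have h0 : ∀ᶠ t : ℝ in 𝓝 0, xs i (xb + t • v + (t ^ 2 / 2) • w) < α i :=
        hc.continuousAt.eventually_lt continuousAt_const (by simpa using h)
      exact (h0.filter_mono nhdsWithin_le_nhds).mono fun t ht => ht.le
    · filter_upwards [self_mem_nhdsWithin] with t ht
      have ht : 0 < t := ht
      simp only [map_add, map_smul, smul_eq_mul, h]
      have h1 := mul_nonpos_of_nonneg_of_nonpos ht.le (hv2 i h)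
      have h2 := mul_nonpos_of_nonneg_of_nonpos (by positivity : 0 ≤ t ^ 2 / 2) (hw2 i h)
      linarith
  have hseq : Tendsto (fun n : ℕ => 1 / ((n : ℝ) + 1)) atTop (𝓝[>] 0) :=
    tendsto_nhdsWithin_iff.2 ⟨tendsto_one_div_add_atTop_nhds_zero_nat,
      Eventually.of_forall fun n => Set.mem_Ioi.2 (by positivity)⟩
  obtain ⟨N, hN⟩ := eventually_atTop.1 (hseq.eventually key)
  refine ⟨fun k => 1 / (((k + N : ℕ) : ℝ) + 1), fun _ => w, fun k => by positivity,
    (tendsto_add_atTop_iff_nat (f := fun n : ℕ => 1 / ((n : ℝ) + 1)) N).2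
      tendsto_one_div_add_atTop_nhds_zero_nat, tendsto_const_nhds,
    fun k => ⟨?_, hN (k + N) (by omega)⟩⟩
  have := AffineSubspace.vadd_mem_of_mem_direction
    (L.direction.add_mem (L.direction.smul_mem (1 / (((k + N : ℕ) : ℝ) + 1)) hv1)
      (L.direction.smul_mem ((1 / (((k + N : ℕ) : ℝ) + 1)) ^ 2 / 2) hw1)) hxb.1
  rw [vadd_eq_add, add_comm, ← add_assoc] at this
  exact this
end

section
/- Let C be a generalized polyhedral convex set in a real Banach space X and let x̄ ∈ C. For any v such that both v and −v belong to the contingent cone T_C(x̄), the second-order tangent sets satisfy T²_C(x̄, −v) = T²_C(x̄, v). -/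
open Filter Topology

theorem cone_aux {X : Type*} [NormedAddCommGroup X] [NormedSpace ℝ X] {p : ℕ}
    (xs : Fin p → (X →L[ℝ] ℝ)) (α : Fin p → ℝ) (L : AffineSubspace ℝ X)
    (hL : IsClosed (L : Set X)) (xb : X) (hxb : xb ∈ L) (v : X)
    (hv : v ∈ contingentCone {x | x ∈ L ∧ ∀ i, xs i x ≤ α i} xb) :
    v ∈ L.direction ∧ ∀ i, xs i xb = α i → xs i v ≤ 0 := by
  obtain ⟨τ, vk, hpos, -, hvk, hmem⟩ := hv
  constructor
  · have h1 : ∀ k, vk k + xb ∈ (L : Set X) := by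
      intro k
      have h := AffineSubspace.vsub_mem_direction (hmem k).1 hxb
      rw [vsub_eq_sub, add_sub_cancel_left] at h
      have h2 : vk k ∈ L.direction := by
        have := L.direction.smul_mem (τ k)⁻¹ h
        rwa [inv_smul_smul₀ (hpos k).ne'] at this
      exact AffineSubspace.vadd_mem_of_mem_direction h2 hxb
    have h3 : v + xb ∈ L := hL.mem_of_tendsto (hvk.add_const xb) (Eventually.of_forall h1)
    have h := AffineSubspace.vsub_mem_direction h3 hxb
    rwa [vsub_eq_sub, add_sub_cancel_right] at h
  · intro i hi
    have ht : Tendsto (fun k => xs i (vk k)) atTop (𝓝 (xs i v)) :=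
      ((xs i).continuous.tendsto v).comp hvk
    refine le_of_tendsto ht (Eventually.of_forall fun k => ?_)
    have h := (hmem k).2 i
    rw [map_add, map_smul, smul_eq_mul, hi] at h
    have := hpos k
    by_contra hc
    push Not at hc
    nlinarith [mul_pos this hc]

theorem second_aux {X : Type*} [NormedAddCommGroup X] [NormedSpace ℝ X] {p : ℕ}
    (xs : Fin p → (X →L[ℝ] ℝ)) (α : Fin p → ℝ) (L : AffineSubspace ℝ X)
    (xb : X) (hxb : ∀ i, xs i xb ≤ α i) (v : X)
    (hv : v ∈ L.direction) (hv0 : ∀ i, xs i xb = α i → xs i v = 0) :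
    secondOrderTangentSet {x | x ∈ L ∧ ∀ i, xs i x ≤ α i} xb v ⊆
      secondOrderTangentSet {x | x ∈ L ∧ ∀ i, xs i x ≤ α i} xb (-v) := by
  rintro w ⟨τ, wk, hpos, hτ, hwk, hmem⟩
  have hlim : Tendsto (fun k => xb + τ k • (-v) + ((τ k) ^ 2 / 2) • wk k) atTop (𝓝 xb) := by
    have := (tendsto_const_nhds (x := xb)).add (hτ.smul_const (-v)) |>.add
      (((hτ.pow 2).div_const 2).smul hwk)
    simpa using this
  have hev : ∀ᶠ k in atTop, ∀ i, xs i (xb + τ k • (-v) + ((τ k) ^ 2 / 2) • wk k) ≤ α i := by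
    rw [eventually_all]
    intro i
    rcases (hxb i).eq_or_lt with hi | hi
    · refine Eventually.of_forall fun k => ?_
      have h := (hmem k).2 i
      simp only [map_add, map_smul, map_neg, hv0 i hi] at h ⊢
      simpa using h
    · have ht := ((xs i).continuous.tendsto xb).comp hlim
      filter_upwards [ht.eventually_lt_const hi] with k hk using hk.le
  obtain ⟨N, hN⟩ := eventually_atTop.1 hev
  refine ⟨fun k => τ (k + N), fun k => wk (k + N), fun k => hpos _,
    hτ.comp (tendsto_add_atTop_nat N), hwk.comp (tendsto_add_atTop_nat N), fun k => ⟨?_, ?_⟩⟩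
  · have h := AffineSubspace.vadd_mem_of_mem_direction
      (L.direction.smul_mem (-2 * τ (k + N)) hv) (hmem (k + N)).1
    rw [vadd_eq_add] at h
    convert h using 1
    module
  · exact hN (k + N) (Nat.le_add_left _ _)

theorem stmt_3 {X : Type*} [NormedAddCommGroup X] [NormedSpace ℝ X] [CompleteSpace X]
    (C : Set X) (hC : IsGPCS C)
    (xb : X) (hxb : xb ∈ C) (v : X)
    (hv : v ∈ contingentCone C xb) (hv' : -v ∈ contingentCone C xb) :
    secondOrderTangentSet C xb (-v) = secondOrderTangentSet C xb v := by
  obtain ⟨p, xs, α, L, hL, rfl⟩ := hC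
  obtain ⟨h1, h2⟩ := cone_aux xs α L hL xb hxb.1 v hv
  obtain ⟨h3, h4⟩ := cone_aux xs α L hL xb hxb.1 (-v) hv'
  have h0 : ∀ i, xs i xb = α i → xs i v = 0 := by
    intro i hi
    have a := h2 i hi
    have b := h4 i hi
    rw [map_neg] at b
    linarith
  apply Set.Subset.antisymm
  · have := second_aux xs α L xb hxb.2 (-v) h3 (fun i hi => by rw [map_neg, h0 i hi, neg_zero])
    rwa [neg_neg] at this
  · exact second_aux xs α L xb hxb.2 v h1 h0
end

section
/- Let X be a real Banach space, f : X → ℝ a Fréchet differentiable function, and C ⊆ X a generalized polyhedral convex set. Suppose x̄ is a local minimum of f on C. Then ⟨∇f(x̄), v⟩ ≥ 0 for every v in the contingent cone T_C(x̄); moreover, if v ∈ T_C(x̄) satisfies ⟨∇f(x̄), v⟩ = 0, then ⟨∇f(x̄), w⟩ ≥ 0 for every w in the second-order tangent set T²_C(x̄, v). -/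
open Filter Topology

theorem aux_first {X : Type*} [NormedAddCommGroup X] [NormedSpace ℝ X]
    (f : X → ℝ) (hf : Differentiable ℝ f)
    (C : Set X) (hC : IsGPCS C)
    (xb : X) (hxb : xb ∈ C)
    (hmin : ∃ ε > 0, ∀ x ∈ C, ‖x - xb‖ ≤ ε → f xb ≤ f x) :
    ∀ x ∈ C, 0 ≤ fderiv ℝ f xb (x - xb) := by
  intro x hx
  have hconv : Convex ℝ C := by
    obtain ⟨p, xs, α, L, -, rfl⟩ := hC
    intro y hy z hz a b ha hb hab
    refine ⟨L.convex hy.1 hz.1 ha hb hab, fun i => ?_⟩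
    have h1 := mul_le_mul_of_nonneg_left (hy.2 i) ha
    have h2 := mul_le_mul_of_nonneg_left (hz.2 i) hb
    have h3 : a * α i + b * α i = α i := by rw [← add_mul, hab, one_mul]
    simp only [map_add, map_smul, smul_eq_mul]
    linarith
  obtain ⟨ε, hε, hm⟩ := hmin
  have hloc : IsLocalMinOn f C xb := by
    have : Metric.closedBall xb ε ∈ 𝓝[C] xb :=
      mem_nhdsWithin_of_mem_nhds (Metric.closedBall_mem_nhds xb hε)
    filter_upwards [this, self_mem_nhdsWithin] with y hy hyC
    exact hm y hyC (by simpa [dist_eq_norm] using hy)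
  exact hloc.hasFDerivWithinAt_nonneg (hf xb).hasFDerivAt.hasFDerivWithinAt
    (sub_mem_posTangentConeAt_of_segment_subset (hconv.segment_subset hxb hx))

theorem stmt_4 {X : Type*} [NormedAddCommGroup X] [NormedSpace ℝ X] [CompleteSpace X]
    (f : X → ℝ) (hf : Differentiable ℝ f)
    (C : Set X) (hC : IsGPCS C)
    (xb : X) (hxb : xb ∈ C)
    (hmin : ∃ ε > 0, ∀ x ∈ C, ‖x - xb‖ ≤ ε → f xb ≤ f x) :
    (∀ v ∈ contingentCone C xb, 0 ≤ fderiv ℝ f xb v) ∧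
    (∀ v ∈ contingentCone C xb, fderiv ℝ f xb v = 0 →
      ∀ w ∈ secondOrderTangentSet C xb v, 0 ≤ fderiv ℝ f xb w) := by
  have key := aux_first f hf C hC xb hxb hmin
  constructor
  · rintro v ⟨τ, vk, hτ, -, hv, hk⟩
    refine ge_of_tendsto' (((fderiv ℝ f xb).continuous.tendsto v).comp hv) fun k => ?_
    have h := key _ (hk k)
    rw [add_sub_cancel_left, map_smul, smul_eq_mul] at h
    exact nonneg_of_mul_nonneg_right h (hτ k)
  · rintro v - h0 w ⟨τ, wk, hτ, -, hw, hk⟩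
    refine ge_of_tendsto' (((fderiv ℝ f xb).continuous.tendsto w).comp hw) fun k => ?_
    have h := key _ (hk k)
    rw [add_assoc, add_sub_cancel_left, map_add, map_smul, map_smul, h0, smul_zero, zero_add,
      smul_eq_mul] at h
    have := hτ k
    exact nonneg_of_mul_nonneg_right h (by positivity)
end

section
/- Let X be a real Banach space, C ⊆ X a nonempty set, and f : X → ℝ a twice continuously differentiable function. If x̄ is a local minimum of f on C, then ⟨∇f(x̄), v⟩ ≥ 0 for every v in the contingent cone T_C(x̄), and for every v ∈ T_C(x̄) with ⟨∇f(x̄), v⟩ = 0 one has ⟨∇f(x̄), w⟩ + ∇²f(x̄)(v, v) ≥ 0 for all w in the second-order tangent set T²_C(x̄, v). -/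
open Filter Topology

theorem taylor2_aux {X : Type*} [NormedAddCommGroup X] [NormedSpace ℝ X]
    (f : X → ℝ) (hf : ContDiff ℝ 2 f) (xb : X) (c : ℝ) (hc : 0 < c) :
    ∃ δ > 0, ∀ h : X, ‖h‖ < δ →
      f (xb + h) - f xb ≤ fderiv ℝ f xb h + (fderiv ℝ (fderiv ℝ f) xb h h) / 2 + c * ‖h‖ ^ 2 := by
  have hd : Differentiable ℝ f := hf.differentiable (by norm_num)
  have hd2 : Differentiable ℝ (fderiv ℝ f) :=
    (hf.fderiv_right (m := 1) (by norm_num)).differentiable (by norm_num)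
  have h1 := (hasFDerivAt_iff_isLittleO_nhds_zero.1 (hd2 xb).hasFDerivAt).def hc
  obtain ⟨δ, hδ, hb⟩ := Metric.eventually_nhds_iff.1 h1
  refine ⟨δ, hδ, fun h hh => ?_⟩
  set A := fderiv ℝ f xb h with hA
  set B := fderiv ℝ (fderiv ℝ f) xb h h with hB
  have hφ : ∀ s : ℝ, HasDerivAt (fun s : ℝ => f (xb + s • h) - s * A - s ^ 2 / 2 * B)
      (fderiv ℝ f (xb + s • h) h - A - s * B) s := by
    intro s
    have e1 : HasDerivAt (fun s : ℝ => xb + s • h) h s := by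
      simpa using ((hasDerivAt_id s).smul_const h).const_add xb
    have e2 := (hd (xb + s • h)).hasFDerivAt.comp_hasDerivAt s e1
    have e3 := (hasDerivAt_id s).mul_const A
    have e4 := (((hasDerivAt_id s).pow 2).div_const 2).mul_const B
    have e5 := (e2.sub e3).sub e4
    have e6 : fderiv ℝ f (xb + s • h) h - A - s * B = fderiv ℝ f (xb + s • h) h - 1 * A
        - ((2 : ℕ) : ℝ) * id s ^ (2 - 1) * 1 / 2 * B := by simp
    rw [e6]
    exact e5
  have hbd : ∀ s ∈ Set.Icc (0:ℝ) 1, ‖fderiv ℝ f (xb + s • h) h - A - s * B‖ ≤ c * ‖h‖ ^ 2 := by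
    intro s hs
    have hsn : ‖s • h‖ ≤ ‖h‖ := by
      rw [norm_smul, Real.norm_of_nonneg hs.1]
      exact mul_le_of_le_one_left (norm_nonneg _) hs.2
    have := hb (y := s • h) (by rw [dist_zero_right]; exact hsn.trans_lt hh)
    have e := ContinuousLinearMap.le_of_opNorm_le _ this h
    have e' : (fderiv ℝ f (xb + s • h) - fderiv ℝ f xb - (fderiv ℝ (fderiv ℝ f) xb) (s • h)) h
        = fderiv ℝ f (xb + s • h) h - A - s * B := by simp [hA, hB]
    rw [e'] at e
    refine e.trans ?_
    have := mul_le_mul_of_nonneg_left hsn hc.le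
    nlinarith [mul_le_mul_of_nonneg_right this (norm_nonneg h)]
  have key := (convex_Icc (0:ℝ) 1).norm_image_sub_le_of_norm_hasDerivWithin_le
    (fun s _ => (hφ s).hasDerivWithinAt) hbd (Set.left_mem_Icc.2 zero_le_one)
    (Set.right_mem_Icc.2 zero_le_one)
  have k2 := (le_abs_self _).trans key
  simp at k2
  linarith

theorem stmt_6 {X : Type*} [NormedAddCommGroup X] [NormedSpace ℝ X] [CompleteSpace X]
    (C : Set X) (hC : C.Nonempty)
    (f : X → ℝ) (hf : ContDiff ℝ 2 f)
    (xb : X) (hxb : xb ∈ C)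
    (hmin : ∃ ε > 0, ∀ x ∈ C, ‖x - xb‖ ≤ ε → f xb ≤ f x) :
    (∀ v ∈ contingentCone C xb, 0 ≤ fderiv ℝ f xb v) ∧
    (∀ v ∈ contingentCone C xb, fderiv ℝ f xb v = 0 →
      ∀ w ∈ secondOrderTangentSet C xb v,
        0 ≤ fderiv ℝ f xb w + fderiv ℝ (fderiv ℝ f) xb v v) := by
  obtain ⟨ε, hε, hm⟩ := hmin
  have main : ∀ c > 0, ∀ (τ : ℕ → ℝ) (u : ℕ → X) (v : X), Tendsto τ atTop (𝓝 0) →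
      Tendsto u atTop (𝓝 v) → (∀ k, xb + τ k • u k ∈ C) →
      ∀ᶠ k in atTop, 0 ≤ τ k * fderiv ℝ f xb (u k)
        + τ k ^ 2 * ((fderiv ℝ (fderiv ℝ f) xb (u k) (u k)) / 2 + c * ‖u k‖ ^ 2) := by
    intro c hc τ u v hτ hu hk
    obtain ⟨δ, hδ, ht⟩ := taylor2_aux f hf xb c hc
    have h0 : Tendsto (fun k => ‖τ k • u k‖) atTop (𝓝 0) := by
      simpa using (hτ.smul hu).norm
    filter_upwards [h0.eventually_lt_const hδ, h0.eventually_lt_const hε] with k h1 h2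
    have a := ht _ h1
    have b := hm _ (hk k) (by simpa using h2.le)
    simp only [map_smul, smul_eq_mul, _root_.smul_apply, norm_smul, mul_pow,
      Real.norm_eq_abs, sq_abs] at a
    linarith
  have hcont : ∀ (u : ℕ → X) (v : X), Tendsto u atTop (𝓝 v) →
      Tendsto (fun k => fderiv ℝ (fderiv ℝ f) xb (u k) (u k)) atTop
        (𝓝 (fderiv ℝ (fderiv ℝ f) xb v v)) := by
    intro u v hu
    have hc2 : Continuous (fun x => fderiv ℝ (fderiv ℝ f) xb x x) :=
      (fderiv ℝ (fderiv ℝ f) xb).continuous.clm_apply continuous_id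
    exact (hc2.tendsto v).comp hu
  have hcont1 : ∀ (u : ℕ → X) (v : X), Tendsto u atTop (𝓝 v) →
      Tendsto (fun k => fderiv ℝ f xb (u k)) atTop (𝓝 (fderiv ℝ f xb v)) := by
    intro u v hu
    exact ((fderiv ℝ f xb).continuous.tendsto v).comp hu
  constructor
  · rintro v ⟨τ, u, hpos, hτ, hu, hk⟩
    have hl : Tendsto (fun k => fderiv ℝ f xb (u k)
        + τ k * ((fderiv ℝ (fderiv ℝ f) xb (u k) (u k)) / 2 + 1 * ‖u k‖ ^ 2)) atTop
        (𝓝 (fderiv ℝ f xb v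
        + 0 * ((fderiv ℝ (fderiv ℝ f) xb v v) / 2 + 1 * ‖v‖ ^ 2))) :=
      (hcont1 u v hu).add (hτ.mul (((hcont u v hu).div_const 2).add ((hu.norm.pow 2).const_mul 1)))
    rw [zero_mul, add_zero] at hl
    refine ge_of_tendsto hl ?_
    filter_upwards [main 1 one_pos τ u v hτ hu hk] with k h
    refine nonneg_of_mul_nonneg_right (a := τ k) ?_ (hpos k)
    linarith
  · rintro v - hv w ⟨τ, wk, hpos, hτ, hw, hk⟩
    have hu : Tendsto (fun k => v + (τ k / 2) • wk k) atTop (𝓝 v) := by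
      simpa using ((hτ.div_const 2).smul hw).const_add v
    have hku : ∀ k, xb + τ k • (v + (τ k / 2) • wk k) ∈ C := by
      intro k
      convert hk k using 1
      rw [smul_add, smul_smul, add_assoc]
      congr 3
      ring
    have hall : ∀ c > 0, 0 ≤ fderiv ℝ f xb w + fderiv ℝ (fderiv ℝ f) xb v v
        + c * (2 * ‖v‖ ^ 2) := by
      intro c hc
      have hl := ((hcont1 wk w hw).add (hcont _ v hu)).add
        (((hu.norm.pow 2).const_mul 2).const_mul c)
      refine ge_of_tendsto hl ?_
      filter_upwards [main c hc τ _ v hτ hu hku] with k h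
      refine nonneg_of_mul_nonneg_right (a := τ k ^ 2 / 2) ?_ (by have := hpos k; positivity)
      have e : fderiv ℝ f xb (v + (τ k / 2) • wk k) = τ k / 2 * fderiv ℝ f xb (wk k) := by
        rw [map_add, hv, map_smul, zero_add, smul_eq_mul]
      rw [e] at h
      linarith
    have hl : Tendsto (fun c : ℝ => fderiv ℝ f xb w + fderiv ℝ (fderiv ℝ f) xb v v
        + c * (2 * ‖v‖ ^ 2)) (𝓝[>] 0) (𝓝 (fderiv ℝ f xb w + fderiv ℝ (fderiv ℝ f) xb v v
        + 0 * (2 * ‖v‖ ^ 2))) :=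
      ((tendsto_id.mul_const _).const_add _).mono_left nhdsWithin_le_nhds
    rw [zero_mul, add_zero] at hl
    refine ge_of_tendsto hl ?_
    filter_upwards [self_mem_nhdsWithin] with c hc using hall c hc
end

section
/- Let X be a real Banach space, C ⊆ X a generalized polyhedral convex set, and f : X → ℝ a twice continuously differentiable function. If x̄ is a local minimum of f on C, then: (i) ⟨∇f(x̄), v⟩ ≥ 0 for all v in the contingent cone T_C(x̄); (ii) for every v ∈ T_C(x̄) with ⟨∇f(x̄), v⟩ = 0 and every w in the second-order tangent set T²_C(x̄, v), one has ⟨∇f(x̄), w⟩ ≥ 0; and (iii) for every v ∈ T_C(x̄) with ⟨∇f(x̄), v⟩ = 0, one has ∇²f(x̄)(v, v) ≥ 0. -/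
open Filter Topology

theorem gpcs_convex {X : Type*} [NormedAddCommGroup X] [NormedSpace ℝ X]
    {C : Set X} (hC : IsGPCS C) : Convex ℝ C := by
  obtain ⟨p, xs, α, L, hL, rfl⟩ := hC
  have h : {x | x ∈ L ∧ ∀ i, xs i x ≤ α i} = (L : Set X) ∩ ⋂ i, {x | xs i x ≤ α i} := by
    ext x; simp
  rw [h]
  exact L.convex.inter (convex_iInter fun i => convex_halfSpace_le (xs i).toLinearMap.isLinear _)

theorem gpcs_dir {X : Type*} [NormedAddCommGroup X] [NormedSpace ℝ X]
    {C : Set X} (hC : IsGPCS C) {xb v : X} (hxb : xb ∈ C) (hv : v ∈ contingentCone C xb) :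
    ∀ᶠ t : ℝ in 𝓝[>] 0, xb + t • v ∈ C := by
  obtain ⟨p, xs, α, L, hL, rfl⟩ := hC
  obtain ⟨τ, vk, hτ, -, hvk, hmem⟩ := hv
  have hdirc : IsClosed (L.direction : Set X) := by
    have : (L.direction : Set X) = (fun y => y + xb) ⁻¹' (L : Set X) := by
      ext y
      have := AffineSubspace.vadd_mem_iff_mem_direction y hxb.1
      simpa using this.symm
    rw [this]
    exact hL.preimage (by fun_prop)
  have hvd : v ∈ L.direction := by
    refine hdirc.mem_of_tendsto hvk (Eventually.of_forall fun k => ?_)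
    have h1 := AffineSubspace.vsub_mem_direction (hmem k).1 hxb.1
    have h2 := L.direction.smul_mem (τ k)⁻¹ h1
    simpa [smul_smul, (hτ k).ne'] using h2
  have hcon : ∀ i, ∀ᶠ t : ℝ in 𝓝[>] 0, xs i (xb + t • v) ≤ α i := by
    intro i
    rcases (hxb.2 i).lt_or_eq with h | h
    · have hc : ContinuousAt (fun t : ℝ => xs i (xb + t • v)) 0 := by fun_prop
      have := hc.eventually_lt (continuousAt_const (y := α i)) (by simpa using h)
      filter_upwards [nhdsWithin_le_nhds this] with t ht using ht.le
    · have hle : xs i v ≤ 0 := by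
        refine le_of_tendsto (((xs i).continuous.tendsto v).comp hvk)
          (Eventually.of_forall fun k => ?_)
        have := (hmem k).2 i
        simp only [map_add, map_smul, smul_eq_mul, h] at this
        simp only [Function.comp]
        have h3 := hτ k
        by_contra hh
        push Not at hh
        nlinarith [mul_pos h3 hh]
      filter_upwards [self_mem_nhdsWithin] with t ht
      have ht : 0 < t := ht
      simp only [map_add, map_smul, smul_eq_mul, h]
      nlinarith
  filter_upwards [eventually_all.2 hcon] with t ht
  refine ⟨?_, ht⟩
  have := AffineSubspace.vadd_mem_of_mem_direction (L.direction.smul_mem t hvd) hxb.1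
  simpa [add_comm] using this

theorem second_order_aux {g g' : ℝ → ℝ} {c : ℝ} (hg : ∀ t, HasDerivAt g (g' t) t)
    (h0 : g' 0 = 0) (hg' : HasDerivAt g' c 0) (hm : ∀ᶠ t in 𝓝[>] 0, g 0 ≤ g t) : 0 ≤ c := by
  by_contra hc
  push Not at hc
  have hs := hg'.hasDerivWithinAt (s := Set.Ioi 0)
  rw [hasDerivWithinAt_iff_tendsto_slope' (by simp)] at hs
  have h1 := (hs.eventually_lt_const hc).and hm
  rw [eventually_nhdsWithin_iff, Metric.eventually_nhds_iff] at h1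
  obtain ⟨δ, hδ, h⟩ := h1
  have hpos : (0:ℝ) < δ / 2 := by positivity
  obtain ⟨s, hs1, hs2⟩ := exists_hasDerivAt_eq_slope g g' hpos
    (fun t _ => (hg t).continuousAt.continuousWithinAt) (fun t _ => hg t)
  have ha := (@h s (by simp [abs_of_pos hs1.1]; linarith [hs1.2]) hs1.1).1
  have hb := (@h (δ/2) (by simp [abs_of_pos hδ]; linarith) hpos).2
  have : 0 ≤ g' s := by
    rw [hs2]; exact div_nonneg (by linarith) (by linarith)
  rw [slope_def_field, h0] at ha
  have : 0 ≤ (g' s - 0) / (s - 0) := div_nonneg (by linarith) (by linarith [hs1.1])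
  linarith

theorem stmt_7 {X : Type*} [NormedAddCommGroup X] [NormedSpace ℝ X] [CompleteSpace X]
    (C : Set X) (hC : IsGPCS C)
    (f : X → ℝ) (hf : ContDiff ℝ 2 f)
    (xb : X) (hxb : xb ∈ C)
    (hmin : ∃ ε > 0, ∀ x ∈ C, ‖x - xb‖ ≤ ε → f xb ≤ f x) :
    (∀ v ∈ contingentCone C xb, 0 ≤ fderiv ℝ f xb v) ∧
    (∀ v ∈ contingentCone C xb, fderiv ℝ f xb v = 0 →
      ∀ w ∈ secondOrderTangentSet C xb v, 0 ≤ fderiv ℝ f xb w) ∧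
    (∀ v ∈ contingentCone C xb, fderiv ℝ f xb v = 0 →
      0 ≤ fderiv ℝ (fderiv ℝ f) xb v v) := by
  obtain ⟨ε, hε, hmin⟩ := hmin
  have hd : Differentiable ℝ f := hf.differentiable (by norm_num)
  have hloc : ∀ᶠ x in 𝓝 xb, x ∈ C → f xb ≤ f x := by
    filter_upwards [Metric.closedBall_mem_nhds xb hε] with x hx hxC
    exact hmin x hxC (by simpa [dist_eq_norm] using hx)
  have key : ∀ y, xb + y ∈ C → 0 ≤ fderiv ℝ f xb y := by
    intro y hy
    have hl : IsLocalMinOn f C xb := eventually_nhdsWithin_iff.2 hloc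
    exact hl.hasFDerivWithinAt_nonneg (hd xb).hasFDerivAt.hasFDerivWithinAt
      (mem_posTangentConeAt_of_segment_subset ((gpcs_convex hC).segment_subset hxb hy))
  refine ⟨?_, ?_, ?_⟩
  · rintro v ⟨τ, vk, hτ, -, hvk, hmem⟩
    refine ge_of_tendsto (((fderiv ℝ f xb).continuous.tendsto v).comp hvk)
      (Eventually.of_forall fun k => ?_)
    have := key _ (hmem k)
    rw [map_smul, smul_eq_mul] at this
    exact nonneg_of_mul_nonneg_right this (hτ k)
  · rintro v - hv0 w ⟨τ, wk, hτ, -, hwk, hmem⟩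
    refine ge_of_tendsto (((fderiv ℝ f xb).continuous.tendsto w).comp hwk)
      (Eventually.of_forall fun k => ?_)
    have h1 := hmem k
    rw [add_assoc] at h1
    have := key _ h1
    rw [map_add, map_smul, map_smul, hv0, smul_zero, zero_add, smul_eq_mul] at this
    have h2 := hτ k
    exact nonneg_of_mul_nonneg_right this (by positivity)
  · intro v hv hv0
    have hl : ∀ t : ℝ, HasDerivAt (fun t : ℝ => xb + t • v) v t := fun t => by
      simpa using ((hasDerivAt_id t).smul_const v).const_add xb
    have hd2 : Differentiable ℝ (fderiv ℝ f) :=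
      (hf.fderiv_right (m := 1) (by norm_num)).differentiable (by norm_num)
    refine second_order_aux (g := fun t : ℝ => f (xb + t • v))
      (g' := fun t : ℝ => fderiv ℝ f (xb + t • v) v) (fun t => ?_) (by simpa using hv0) ?_ ?_
    · exact (hd _).hasFDerivAt.comp_hasDerivAt t (hl t)
    · have h1 : HasDerivAt (fun t : ℝ => fderiv ℝ f (xb + t • v))
          (fderiv ℝ (fderiv ℝ f) (xb + (0:ℝ) • v) v) 0 :=
        (hd2 _).hasFDerivAt.comp_hasDerivAt (0:ℝ) (hl 0)
      have h2 := h1.clm_apply (hasDerivAt_const (0:ℝ) v)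
      simpa using h2
    · have hc : Tendsto (fun t : ℝ => xb + t • v) (𝓝[>] 0) (𝓝 xb) := by
        have := (hl 0).continuousAt.tendsto
        simp only [zero_smul, add_zero] at this
        exact this.mono_left nhdsWithin_le_nhds
      filter_upwards [hc.eventually hloc, gpcs_dir hC hxb hv] with t h1 h2
      simpa using h1 h2
end

section
/- Let X be a real Banach space, C ⊆ X a generalized polyhedral convex set, M : X → X* a bounded linear operator into the topological dual that is symmetric (⟨Mx, y⟩ = ⟨My, x⟩ for all x, y ∈ X), q ∈ X*, α ∈ ℝ, and define f(x) = (1/2)⟨Mx, x⟩ + ⟨q, x⟩ + α. If x̄ is a local minimum of f on C, then: (c0) ⟨Mx̄ + q, v⟩ ≥ 0 for all v in the contingent cone T_C(x̄); (c1') for every v ∈ T_C(x̄) with ⟨Mx̄ + q, v⟩ = 0 and every w in the second-order tangent set T²_C(x̄, v), one has ⟨Mx̄ + q, w⟩ ≥ 0; and (c2') ⟨Mv, v⟩ ≥ 0 for every v ∈ T_C(x̄) with ⟨Mx̄ + q, v⟩ = 0. -/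
open Filter Topology

theorem gpcs_radial {X : Type*} [NormedAddCommGroup X] [NormedSpace ℝ X]
    {C : Set X} (hC : IsGPCS C) {xb : X} (hxb : xb ∈ C) {v : X}
    (hv : v ∈ contingentCone C xb) : ∀ᶠ t : ℝ in 𝓝[>] 0, xb + t • v ∈ C := by
  obtain ⟨p, xs, a, L, hL, rfl⟩ := hC
  obtain ⟨τ, vk, hτ, hτ0, hvk, hmem⟩ := hv
  have hxL : xb ∈ L := hxb.1
  have hcl : IsClosed {u : X | xb + u ∈ L} := hL.preimage (continuous_const.add continuous_id)
  have hline : ∀ u : X, xb + u ∈ L → ∀ t : ℝ, xb + t • u ∈ L := by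
    intro u hu t
    have := AffineMap.lineMap_mem t hxL hu
    rw [AffineMap.lineMap_apply] at this
    simpa [add_comm] using this
  have hvL : xb + v ∈ L := by
    refine hcl.mem_of_tendsto hvk (Eventually.of_forall fun k => ?_)
    have := hline _ (hmem k).1 (τ k)⁻¹
    rwa [smul_smul, inv_mul_cancel₀ (hτ k).ne', one_smul] at this
  have hi : ∀ i, ∀ᶠ t : ℝ in 𝓝[>] 0, xs i (xb + t • v) ≤ a i := by
    intro i
    rcases (hxb.2 i).lt_or_eq with h | h
    · have hc : Tendsto (fun t : ℝ => xs i (xb + t • v)) (𝓝[>] 0) (𝓝 (xs i (xb + (0:ℝ) • v))) :=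
        (Continuous.tendsto (by fun_prop) 0).mono_left nhdsWithin_le_nhds
      rw [zero_smul, add_zero] at hc
      exact (hc.eventually_lt_const h).mono fun t ht => ht.le
    · have hv0 : xs i v ≤ 0 := by
        refine le_of_tendsto (((xs i).continuous.tendsto v).comp hvk)
          (Eventually.of_forall fun k => ?_)
        have h2 := (hmem k).2 i
        rw [map_add, map_smul, smul_eq_mul, h] at h2
        have h3 := hτ k
        show xs i (vk k) ≤ 0
        by_contra hcon
        push Not at hcon
        have := mul_pos h3 hcon
        linarith
      filter_upwards [self_mem_nhdsWithin] with t ht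
      rw [map_add, map_smul, smul_eq_mul, h]
      have : t * xs i v ≤ 0 := mul_nonpos_of_nonneg_of_nonpos (le_of_lt ht) hv0
      linarith
  filter_upwards [eventually_all.2 hi] with t ht
  exact ⟨hline v hvL t, ht⟩

theorem gpcs_feasible {X : Type*} [NormedAddCommGroup X] [NormedSpace ℝ X]
    {C : Set X} (hC : IsGPCS C) {xb u : X} (hxb : xb ∈ C) (hu : xb + u ∈ C) :
    u ∈ contingentCone C xb := by
  refine ⟨fun k => 1 / ((k : ℝ) + 1), fun _ => u, fun k => by positivity,
    tendsto_one_div_add_atTop_nhds_zero_nat, tendsto_const_nhds, fun k => ?_⟩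
  have hk : (1:ℝ) / ((k : ℝ) + 1) ≤ 1 := by
    rw [div_le_one (by positivity)]
    have : (0:ℝ) ≤ k := by positivity
    linarith
  exact (gpcs_convex hC).add_smul_mem hxb hu ⟨by positivity, hk⟩

theorem stmt_8 {X : Type*} [NormedAddCommGroup X] [NormedSpace ℝ X] [CompleteSpace X]
    (C : Set X) (hC : IsGPCS C)
    (M : X →L[ℝ] X →L[ℝ] ℝ) (hM : ∀ x y : X, M x y = M y x)
    (q : X →L[ℝ] ℝ) (α : ℝ)
    (f : X → ℝ) (hf : f = fun x => (1 / 2 : ℝ) * M x x + q x + α)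
    (xb : X) (hxb : xb ∈ C)
    (hmin : ∃ ε > 0, ∀ x ∈ C, ‖x - xb‖ ≤ ε → f xb ≤ f x) :
    (∀ v ∈ contingentCone C xb, 0 ≤ M xb v + q v) ∧
    (∀ v ∈ contingentCone C xb, M xb v + q v = 0 →
      ∀ w ∈ secondOrderTangentSet C xb v, 0 ≤ M xb w + q w) ∧
    (∀ v ∈ contingentCone C xb, M xb v + q v = 0 → 0 ≤ M v v) := by
  obtain ⟨ε, hε, hmin⟩ := hmin
  have key : ∀ v ∈ contingentCone C xb,
      ∀ᶠ t : ℝ in 𝓝[>] 0, 0 ≤ (M xb v + q v) + t / 2 * M v v := by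
    intro v hv
    have hn : Tendsto (fun t : ℝ => ‖(xb + t • v) - xb‖) (𝓝[>] 0)
        (𝓝 ‖(xb + (0:ℝ) • v) - xb‖) :=
      (Continuous.tendsto (by fun_prop) 0).mono_left nhdsWithin_le_nhds
    have hz : ‖(xb + (0:ℝ) • v) - xb‖ = 0 := by simp
    rw [hz] at hn
    filter_upwards [gpcs_radial hC hxb hv, hn.eventually_lt_const hε, self_mem_nhdsWithin]
      with t h1 h2 h3
    have h4 := hmin _ h1 h2.le
    have h5 : (0:ℝ) < t := h3
    rw [hf] at h4
    simp only [map_add, map_smul, add_apply, smul_apply,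
      ContinuousLinearMap.add_apply, ContinuousLinearMap.smul_apply, smul_eq_mul] at h4
    rw [hM v xb] at h4
    have h6 : 0 ≤ t * ((M xb v + q v) + t / 2 * M v v) := by nlinarith
    exact nonneg_of_mul_nonneg_right h6 h5
  have c0 : ∀ v ∈ contingentCone C xb, 0 ≤ M xb v + q v := by
    intro v hv
    have hc : Tendsto (fun t : ℝ => (M xb v + q v) + t / 2 * M v v) (𝓝[>] 0)
        (𝓝 ((M xb v + q v) + 0 / 2 * M v v)) :=
      (Continuous.tendsto (f := fun t : ℝ => (M xb v + q v) + t / 2 * M v v)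
        (by fun_prop) 0).mono_left nhdsWithin_le_nhds
    have := ge_of_tendsto hc (key v hv)
    simpa using this
  refine ⟨c0, ?_, ?_⟩
  · rintro v hv hv0 w ⟨τ, wk, hτ, hτ0, hwk, hmem⟩
    have hc : Tendsto (fun k => (M xb + q) (wk k)) atTop (𝓝 ((M xb + q) w)) :=
      ((M xb + q).continuous.tendsto w).comp hwk
    refine ge_of_tendsto hc (Eventually.of_forall fun k => ?_)
    have h1 := hmem k
    rw [add_assoc] at h1
    have h2 := c0 _ (gpcs_feasible hC hxb h1)
    simp only [map_add, map_smul, smul_eq_mul] at h2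
    have h3 : 0 < τ k ^ 2 / 2 := by have := hτ k; positivity
    have h4 : 0 ≤ τ k ^ 2 / 2 * (M xb (wk k) + q (wk k)) := by
      have : τ k * (M xb v + q v) = 0 := by rw [hv0, mul_zero]
      linarith
    exact nonneg_of_mul_nonneg_right h4 h3
  · intro v hv hv0
    obtain ⟨t, ht, ht0⟩ := ((key v hv).and self_mem_nhdsWithin).exists
    have ht1 : (0:ℝ) < t := ht0
    rw [hv0, zero_add] at ht
    exact nonneg_of_mul_nonneg_right ht (by positivity)
end

section
/- Let f : ℝ² → ℝ, f(x₁, x₂) = −2x₁² − x₂², and C = {(x₁, x₂) ∈ ℝ² : 2x₁² + 3x₂² − 6 ≤ 0}. Then x̄¹ = (√3, 0) and x̄² = (−√3, 0) are global minima of f on C (i.e., f(x̄¹) = f(x̄²) = −6 ≤ f(x) for all x ∈ C). Moreover, the vector v = (0, 1) belongs to the contingent cone T_C(x̄¹), satisfies ⟨∇f(x̄¹), v⟩ = 0, and yet ⟨∇²f(x̄¹)v, v⟩ = −2 < 0; hence the second-order condition '⟨∇²f(x̄)v, v⟩ ≥ 0 for all v ∈ T_C(x̄) with ⟨∇f(x̄),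 v⟩ = 0' fails at x̄¹ even though C is compact and convex. -/
open Filter Topology

theorem stmt_14
    (f : ℝ × ℝ → ℝ) (hf : ∀ x : ℝ × ℝ, f x = -2 * x.1 ^ 2 - x.2 ^ 2)
    (C : Set (ℝ × ℝ)) (hC : C = {x : ℝ × ℝ | 2 * x.1 ^ 2 + 3 * x.2 ^ 2 - 6 ≤ 0})
    (xb1 xb2 : ℝ × ℝ) (hxb1 : xb1 = (Real.sqrt 3, 0)) (hxb2 : xb2 = (-Real.sqrt 3, 0))
    (v : ℝ × ℝ) (hv : v = (0, 1)) :
    xb1 ∈ C ∧ xb2 ∈ C ∧ f xb1 = -6 ∧ f xb2 = -6 ∧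
    (∀ x ∈ C, f xb1 ≤ f x) ∧ (∀ x ∈ C, f xb2 ≤ f x) ∧
    v ∈ contingentCone C xb1 ∧
    fderiv ℝ f xb1 v = 0 ∧
    fderiv ℝ (fderiv ℝ f) xb1 v v = -2 ∧ (-2 : ℝ) < 0 ∧
    ¬ (∀ u ∈ contingentCone C xb1, fderiv ℝ f xb1 u = 0 →
        0 ≤ fderiv ℝ (fderiv ℝ f) xb1 u u) := by
  have h3 : Real.sqrt 3 ^ 2 = 3 := Real.sq_sqrt (by norm_num)
  have h1 : 3 / 2 ≤ Real.sqrt 3 := Real.le_sqrt_of_sq_le (by norm_num)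
  have hd : fderiv ℝ f = fun x : ℝ × ℝ =>
      (-4 * x.1) • ContinuousLinearMap.fst ℝ ℝ ℝ + (-2 * x.2) • ContinuousLinearMap.snd ℝ ℝ ℝ := by
    funext x
    have hf' : f = fun x : ℝ × ℝ => -2 * x.1 ^ 2 - x.2 ^ 2 := funext hf
    rw [hf']
    apply HasFDerivAt.fderiv
    have a : HasFDerivAt (fun x : ℝ × ℝ => x.1) (ContinuousLinearMap.fst ℝ ℝ ℝ) x := hasFDerivAt_fst
    have b : HasFDerivAt (fun x : ℝ × ℝ => x.2) (ContinuousLinearMap.snd ℝ ℝ ℝ) x := hasFDerivAt_snd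
    refine (((a.pow 2).const_mul (-2)).sub (b.pow 2)).congr_fderiv ?_
    ext <;> simp <;> ring
  have hdd : fderiv ℝ (fderiv ℝ f) xb1 v v = -2 := by
    rw [hd]
    have a : HasFDerivAt (fun x : ℝ × ℝ => -4 * x.1) ((-4 : ℝ) • ContinuousLinearMap.fst ℝ ℝ ℝ) xb1 :=
      HasFDerivAt.const_mul (hasFDerivAt_fst (𝕜 := ℝ) (E := ℝ) (F := ℝ) (p := xb1)) (-4)
    have b : HasFDerivAt (fun x : ℝ × ℝ => -2 * x.2) ((-2 : ℝ) • ContinuousLinearMap.snd ℝ ℝ ℝ) xb1 :=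
      HasFDerivAt.const_mul (hasFDerivAt_snd (𝕜 := ℝ) (E := ℝ) (F := ℝ) (p := xb1)) (-2)
    have c := (a.smul_const (ContinuousLinearMap.fst ℝ ℝ ℝ)).add
      (b.smul_const (ContinuousLinearMap.snd ℝ ℝ ℝ))
    have e := c.fderiv
    simp only [Pi.add_def] at e
    rw [e, hv]
    simp
  have hd0 : fderiv ℝ f xb1 v = 0 := by
    rw [hd, hv, hxb1]; simp
  have hcone : v ∈ contingentCone C xb1 := by
    have ht := tendsto_one_div_add_atTop_nhds_zero_nat (𝕜 := ℝ)
    refine ⟨fun k => 1 / ((k : ℝ) + 1), fun k => (-(1 / ((k : ℝ) + 1)), 1),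
      fun k => by positivity, ht, ?_, ?_⟩
    · rw [hv]
      have := ht.neg
      rw [neg_zero] at this
      exact this.prodMk_nhds tendsto_const_nhds
    · intro k
      have t0 : 0 < 1 / ((k : ℝ) + 1) := by positivity
      have t1 : 1 / ((k : ℝ) + 1) ≤ 1 := by
        rw [div_le_one (by positivity)]
        have : (0 : ℝ) ≤ k := by positivity
        linarith
      simp only []
      generalize 1 / ((k : ℝ) + 1) = t at t0 t1
      rw [hC, hxb1]
      simp only [Set.mem_ofPred_eq, Prod.smul_mk, Prod.mk_add_mk, smul_eq_mul]
      have t2 : t ^ 2 ≤ 1 := by nlinarith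
      have key : 0 ≤ t ^ 2 * (4 * Real.sqrt 3 - 3 - 2 * t ^ 2) :=
        mul_nonneg (sq_nonneg t) (by linarith)
      linear_combination key + 2 * h3
  have hf1 : f xb1 = -6 := by rw [hf, hxb1]; simp only; linear_combination -2 * h3
  have hf2 : f xb2 = -6 := by rw [hf, hxb2]; simp only; linear_combination -2 * h3
  have hmin : ∀ x ∈ C, -6 ≤ f x := by
    intro x hx
    rw [hC, Set.mem_ofPred_eq] at hx
    rw [hf]
    nlinarith [sq_nonneg x.2]
  refine ⟨?_, ?_, hf1, hf2, fun x hx => hf1 ▸ hmin x hx, fun x hx => hf2 ▸ hmin x hx,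
    hcone, hd0, hdd, by norm_num, ?_⟩
  · rw [hC, hxb1, Set.mem_ofPred_eq]; simp only; linear_combination 2 * h3
  · rw [hC, hxb2, Set.mem_ofPred_eq]; simp only; linear_combination 2 * h3
  · intro h
    have := h v hcone hd0
    rw [hdd] at this
    linarith
end

section
/- Let f : ℝ² → ℝ, f(x₁, x₂) = −x₁² − x₂², and C = {(x₁, x₂) ∈ ℝ² : x₁² + 2x₂² − 1 = 0}. Then x̄¹ = (1, 0) and x̄² = (−1, 0) are global minima of f on C (i.e., f(x̄¹) = f(x̄²) = −1 ≤ f(x) for all x ∈ C). Moreover, the vector v = (0, 1) belongs to the contingent cone T_C(x̄²), satisfies ⟨∇f(x̄²), v⟩ = 0, and yet ⟨∇²f(x̄²)v, v⟩ = −2 < 0; hence the second-order condition '⟨∇²f(x̄)v, v⟩ ≥ 0 for all v ∈ T_C(x̄) with ⟨∇f(x̄), v⟩ = 0' fails at x̄². -/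
open Filter Topology

theorem stmt_15
    (f : ℝ × ℝ → ℝ) (hf : ∀ x : ℝ × ℝ, f x = -x.1 ^ 2 - x.2 ^ 2)
    (C : Set (ℝ × ℝ)) (hC : C = {x : ℝ × ℝ | x.1 ^ 2 + 2 * x.2 ^ 2 - 1 = 0})
    (xb1 xb2 : ℝ × ℝ) (hxb1 : xb1 = (1, 0)) (hxb2 : xb2 = (-1, 0))
    (v : ℝ × ℝ) (hv : v = (0, 1)) :
    xb1 ∈ C ∧ xb2 ∈ C ∧ f xb1 = -1 ∧ f xb2 = -1 ∧
    (∀ x ∈ C, f xb1 ≤ f x) ∧ (∀ x ∈ C, f xb2 ≤ f x) ∧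
    v ∈ contingentCone C xb2 ∧
    fderiv ℝ f xb2 v = 0 ∧
    fderiv ℝ (fderiv ℝ f) xb2 v v = -2 ∧ (-2 : ℝ) < 0 ∧
    ¬ (∀ u ∈ contingentCone C xb2, fderiv ℝ f xb2 u = 0 →
        0 ≤ fderiv ℝ (fderiv ℝ f) xb2 u u) := by
  have hfd : ∀ x : ℝ × ℝ, HasFDerivAt f
      ((-2 * x.1) • ContinuousLinearMap.fst ℝ ℝ ℝ + (-2 * x.2) • ContinuousLinearMap.snd ℝ ℝ ℝ) x := by
    intro x
    have h1 : HasFDerivAt (fun y : ℝ × ℝ => y.1) (ContinuousLinearMap.fst ℝ ℝ ℝ) x := hasFDerivAt_fst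
    have h2 : HasFDerivAt (fun y : ℝ × ℝ => y.2) (ContinuousLinearMap.snd ℝ ℝ ℝ) x := hasFDerivAt_snd
    have hff : f = fun y : ℝ × ℝ => -(y.1 * y.1) - y.2 * y.2 := by
      funext y; rw [hf]; ring
    rw [hff]
    refine ((h1.mul h1).neg.sub (h2.mul h2)).congr_fderiv ?_
    ext <;> simp <;> ring
  have hfe : fderiv ℝ f = fun x : ℝ × ℝ =>
      (-2 * x.1) • ContinuousLinearMap.fst ℝ ℝ ℝ + (-2 * x.2) • ContinuousLinearMap.snd ℝ ℝ ℝ :=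
    funext fun x => (hfd x).fderiv
  have hG : fderiv ℝ (fderiv ℝ f) xb2 v v = -2 := by
    have h1 : HasFDerivAt (fun y : ℝ × ℝ => y.1) (ContinuousLinearMap.fst ℝ ℝ ℝ) xb2 := hasFDerivAt_fst
    have h2 : HasFDerivAt (fun y : ℝ × ℝ => y.2) (ContinuousLinearMap.snd ℝ ℝ ℝ) xb2 := hasFDerivAt_snd
    have h := ((h1.const_mul (-2 : ℝ)).smul_const (ContinuousLinearMap.fst ℝ ℝ ℝ)).add
      ((h2.const_mul (-2 : ℝ)).smul_const (ContinuousLinearMap.snd ℝ ℝ ℝ))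
    rw [hfe]
    erw [h.fderiv]; rw [hv]
    simp
  have hg : fderiv ℝ f xb2 v = 0 := by
    rw [hfe, hv, hxb2]; simp
  have hT : v ∈ contingentCone C xb2 := by
    have hs : Tendsto (fun k : ℕ => 1 / ((k : ℝ) + 1)) atTop (𝓝 0) :=
      tendsto_one_div_add_atTop_nhds_zero_nat
    refine ⟨fun k => 2 * (1 / ((k : ℝ) + 1)),
      fun k => (2 * (1 / ((k : ℝ) + 1)) / (1 + 2 * (1 / ((k : ℝ) + 1)) ^ 2),
        1 / (1 + 2 * (1 / ((k : ℝ) + 1)) ^ 2)), fun k => by positivity, ?_, ?_, ?_⟩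
    · simpa using hs.const_mul 2
    · have hc : ContinuousAt (fun s : ℝ => (2 * s / (1 + 2 * s ^ 2), 1 / (1 + 2 * s ^ 2))) 0 := by
        refine ContinuousAt.prodMk (ContinuousAt.div (by fun_prop) (by fun_prop) (by norm_num))
          (ContinuousAt.div (by fun_prop) (by fun_prop) (by norm_num))
      have h := hc.tendsto.comp hs
      rw [hv]
      simpa [Function.comp_def] using h
    · intro k
      rw [hC, hxb2]
      generalize 1 / ((k : ℝ) + 1) = s
      have hp : (1 + 2 * s ^ 2) ≠ 0 := by positivity
      simp only [Set.mem_ofPred_eq, Prod.smul_mk, Prod.mk_add_mk, smul_eq_mul]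
      field_simp
      ring
  refine ⟨by simp [hC, hxb1], by simp [hC, hxb2], by simp [hf, hxb1], by simp [hf, hxb2], ?_, ?_,
    hT, hg, hG, by norm_num, ?_⟩
  · intro x hx
    rw [hC, Set.mem_ofPred_eq] at hx
    rw [hf, hf, hxb1]
    nlinarith [sq_nonneg x.2]
  · intro x hx
    rw [hC, Set.mem_ofPred_eq] at hx
    rw [hf, hf, hxb2]
    nlinarith [sq_nonneg x.2]
  · intro h
    have := h v hT hg
    rw [hG] at this
    norm_num at this
end
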